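/- Assume K is algebraically closed. If 𝔪 is a maximal ideal of R with t_i ∈ 𝔪 for some i ∈ {1,…,n}, then for every g = (g_1,…,g_n) ∈ ℤ^n one has t_i ∈ σ_g(𝔪) if and only if g_i = 0. -/

import Mathlib

namespace MTW

abbrev Exp (n : ℕ) : Type := (Fin n → ℤ) × (Fin n → ℤ)

abbrev LR (K : Type) [Field K] (n : ℕ) : Type := AddMonoidAlgebra K (Exp n)

noncomputable def mon (K : Type) [Field K] (n : ℕ) (d : Exp n) : LR K n :=
  AddMonoidAlgebra.single d 1

noncomputable def U (K : Type) [Field K] (n : ℕ) (j : Fin n) : LR K n :=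
  mon K n (Pi.single j 1, 0)

noncomputable def V (K : Type) [Field K] (n : ℕ) (j : Fin n) : LR K n :=
  mon K n (0, Pi.single j 1)

noncomputable def tElt (K : Type) [Field K] (n : ℕ) (k : ℤ) (r s : Fin n → Fin n → K)
    (i : Fin n) : LR K n :=
  (r i i ^ k - s i i ^ k)⁻¹ •
    (r i i ^ k • mon K n (Pi.single i k, 0) - s i i ^ k • mon K n (0, Pi.single i k))

noncomputable def sigmaZ (K : Type) [Field K] (n : ℕ)
    (σ : Fin n → (LR K n ≃ₐ[K] LR K n)) (g : Fin n → ℤ) : LR K n ≃ₐ[K] LR K n :=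
  (List.ofFn fun i => σ i ^ (g i)).prod

def IsInvariantIdeal (K : Type) [Field K] (n : ℕ)
    (σ : Fin n → (LR K n ≃ₐ[K] LR K n)) (J : Ideal (LR K n)) : Prop :=
  ∀ (g : Fin n → ℤ), ∀ x ∈ J, sigmaZ K n σ g x ∈ J

noncomputable def invariants (K : Type) [Field K] (n : ℕ)
    (σ : Fin n → (LR K n ≃ₐ[K] LR K n)) : Subalgebra K (LR K n) :=
  ⨅ i, AlgHom.equalizer (σ i).toAlgHom (AlgHom.id K (LR K n))

/-- An eigenvector of an automorphism is an eigenvector of its integer powers. -/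
lemma zpow_apply_eq_smul {K A : Type*} [Field K] [Ring A] [Algebra K A] (e : A ≃ₐ[K] A)
    {x : A} {c : K} (hc : c ≠ 0) (h : e x = c • x) (z : ℤ) : (e ^ z) x = c ^ z • x := by
  have hinv : e⁻¹ x = c⁻¹ • x := by
    apply e.injective
    rw [← AlgEquiv.mul_apply, mul_inv_cancel, map_smul, h, smul_smul, inv_mul_cancel₀ hc,
      one_smul, AlgEquiv.one_apply]
  induction z with
  | zero => simp
  | succ m ih =>
    rw [zpow_add_one, AlgEquiv.mul_apply, h, map_smul, ih, smul_smul, zpow_add_one₀ hc, mul_comm]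
  | pred m ih =>
    rw [zpow_sub_one, AlgEquiv.mul_apply, hinv, map_smul, ih, smul_smul, zpow_sub_one₀ hc,
      mul_comm]

/-- A common eigenvector of a list of automorphisms is an eigenvector of their product. -/
lemma prod_ofFn_apply_eq_smul {K A : Type*} [Field K] [Ring A] [Algebra K A] {n : ℕ}
    (e : Fin n → (A ≃ₐ[K] A)) {x : A} (c : Fin n → K) (h : ∀ i, e i x = c i • x) :
    (List.ofFn e).prod x = (∏ i, c i) • x := by
  induction n with
  | zero => simp
  | succ n ih =>
    rw [List.ofFn_succ, List.prod_cons, AlgEquiv.mul_apply,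
      ih (fun i => e i.succ) (fun i => c i.succ) (fun i => h i.succ), map_smul, h, smul_smul,
      Fin.prod_univ_succ, mul_comm]

lemma mon_add (K : Type) [Field K] (n : ℕ) (d d' : Exp n) :
    mon K n (d + d') = mon K n d * mon K n d' := by
  simp [mon, AddMonoidAlgebra.single_mul_single]

lemma mon_zero (K : Type) [Field K] (n : ℕ) : mon K n 0 = 1 := rfl

lemma isUnit_mon (K : Type) [Field K] (n : ℕ) (d : Exp n) : IsUnit (mon K n d) :=
  IsUnit.of_mul_eq_one (mon K n (-d)) (by rw [← mon_add, add_neg_cancel, mon_zero])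

/-- If a monomial is an eigenvector of an algebra automorphism, so are its integer powers. -/
lemma apply_mon_zsmul {K : Type} [Field K] {n : ℕ} (e : LR K n ≃ₐ[K] LR K n) {d : Exp n} {c : K}
    (hc : c ≠ 0) (h : e (mon K n d) = c • mon K n d) (z : ℤ) :
    e (mon K n (z • d)) = c ^ z • mon K n (z • d) := by
  have hneg : e (mon K n (-d)) = c⁻¹ • mon K n (-d) := by
    apply ((isUnit_mon K n d).map e).mul_left_cancel
    rw [← map_mul, ← mon_add, add_neg_cancel, mon_zero, map_one, h, smul_mul_smul_comm,
      ← mon_add, add_neg_cancel, mon_zero, mul_inv_cancel₀ hc, one_smul]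
  induction z with
  | zero => simp [mon_zero]
  | succ m ih =>
    rw [add_smul, one_smul, mon_add, map_mul, ih, h, smul_mul_smul_comm, zpow_add_one₀ hc]
  | pred m ih =>
    rw [sub_smul, one_smul, sub_eq_add_neg, mon_add, map_mul, ih, hneg, smul_mul_smul_comm,
      zpow_sub_one₀ hc]

/-- The action of `sigmaZ` on powers of a monomial that is an eigenvector of every `σ i`. -/
lemma sigmaZ_mon_zsmul {K : Type} [Field K] {n : ℕ} (σ : Fin n → (LR K n ≃ₐ[K] LR K n))
    {d : Exp n} {c : Fin n → K} (hc : ∀ i, c i ≠ 0)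
    (h : ∀ i, σ i (mon K n d) = (c i)⁻¹ • mon K n d) (g : Fin n → ℤ) (k : ℤ) :
    sigmaZ K n σ g (mon K n (k • d)) = (∏ i, (c i ^ k) ^ g i)⁻¹ • mon K n (k • d) := by
  rw [sigmaZ, prod_ofFn_apply_eq_smul _ (fun i => ((c i)⁻¹ ^ k) ^ g i) fun i =>
    zpow_apply_eq_smul _ (zpow_ne_zero _ (inv_ne_zero (hc i)))
      (apply_mon_zsmul _ (inv_ne_zero (hc i)) (h i) k) _]
  simp only [inv_zpow, Finset.prod_inv_distrib]

/-- A field element of which no positive power is `1` has no nontrivial integer power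
equal to `1`. -/
lemma zpow_eq_one_iff_of_forall_pow_ne_one {K : Type*} [Field K] {q : K}
    (hq : ∀ m : ℕ, 0 < m → q ^ m ≠ 1) (z : ℤ) : q ^ z = 1 ↔ z = 0 := by
  refine ⟨fun h => ?_, fun h => by simp [h]⟩
  by_contra hz
  refine hq z.natAbs (Int.natAbs_pos.mpr hz) ?_
  rcases Int.natAbs_eq z with hz' | hz'
  · rwa [hz', zpow_natCast] at h
  · rwa [hz', zpow_neg, zpow_natCast, inv_eq_one] at h

/-- If `p • X - q • Y` lies in a proper ideal, with `q ≠ 0` and `Y` a unit, then rescaling `X` by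
`a` and `Y` by `b` stays in the ideal exactly when `a = b`. -/
lemma smul_sub_smul_mem_iff {K A : Type*} [Field K] [CommRing A] [Algebra K A] {I : Ideal A}
    (hI : I ≠ ⊤) {p q : K} (hq : q ≠ 0) {X Y : A} (hY : IsUnit Y) (h : p • X - q • Y ∈ I)
    (a b : K) : p • a • X - q • b • Y ∈ I ↔ a = b := by
  have hd : p • a • X - q • b • Y = a • (p • X - q • Y) + ((a - b) * q) • Y := by
    module
  rw [hd, I.add_mem_iff_right (Submodule.smul_of_tower_mem I a h)]
  refine ⟨fun hmem => ?_, fun hab => by simp [hab]⟩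
  by_contra hab
  have hne : (a - b) * q ≠ 0 := mul_ne_zero (sub_ne_zero.mpr hab) hq
  refine hI (I.eq_top_of_isUnit_mem ?_ hY)
  exact ((I.restrictScalars K).smul_mem_iff hne).mp hmem

/-- Over an algebraically closed field, if `𝔪` is a maximal ideal of
`R` with `t_i ∈ 𝔪`, then for every `g ∈ ℤ^n`: `t_i ∈ σ_g(𝔪)` iff `g_i = 0`. -/
theorem statement9
    (K : Type) [Field K] [IsAlgClosed K] (n : ℕ) (hn : 0 < n)
    (k : ℤ) (hk : k ≠ 0) (r s : Fin n → Fin n → K)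
    (hr : ∀ i j, r i j ≠ 0) (hs : ∀ i j, s i j ≠ 0)
    (hroot : ∀ i, ∀ m : ℕ, 0 < m → (r i i / s i i) ^ m ≠ 1)
    (hrs : ∀ i j, i ≠ j → r i j ^ k = s i j ^ k)
    (σ : Fin n → (LR K n ≃ₐ[K] LR K n))
    (hσu : ∀ i j, σ i (U K n j) = (r i j)⁻¹ • U K n j)
    (hσv : ∀ i j, σ i (V K n j) = (s i j)⁻¹ • V K n j)
    (𝔪 : Ideal (LR K n)) (h𝔪 : 𝔪.IsMaximal)
    (i : Fin n) (hti : tElt K n k r s i ∈ 𝔪) (g : Fin n → ℤ) :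
    tElt K n k r s i ∈ Ideal.map (sigmaZ K n σ g) 𝔪 ↔ g i = 0 := by
  have hq : (r i i / s i i) ^ k ≠ 1 := fun h =>
    hk ((zpow_eq_one_iff_of_forall_pow_ne_one (hroot i) k).mp h)
  have hden : (r i i ^ k - s i i ^ k)⁻¹ ≠ 0 := by
    refine inv_ne_zero (sub_ne_zero.mpr fun h => hq ?_)
    rw [div_zpow, h, div_self (zpow_ne_zero _ (hs i i))]
  set X := mon K n (Pi.single i k, 0) with hX
  set Y := mon K n (0, Pi.single i k) with hY
  have hX' : X = mon K n (k • (Pi.single i 1, 0)) := by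
    rw [hX, Prod.smul_mk, ← Pi.single_smul, smul_zero, smul_eq_mul, mul_one]
  have hY' : Y = mon K n (k • (0, Pi.single i 1)) := by
    rw [hY, Prod.smul_mk, ← Pi.single_smul, smul_zero, smul_eq_mul, mul_one]
  have hmem : ∀ (J : Ideal (LR K n)) (x : LR K n),
      (r i i ^ k - s i i ^ k)⁻¹ • x ∈ J ↔ x ∈ J := fun J x =>
    (J.restrictScalars K).smul_mem_iff hden
  -- `σ_g⁻¹` rescales the two monomials by `a` and `b`.
  set a := ∏ j, (r j i ^ k) ^ g j with ha
  set b := ∏ j, (s j i ^ k) ^ g j with hb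
  have ha0 : a ≠ 0 := Finset.prod_ne_zero_iff.mpr fun j _ =>
    zpow_ne_zero _ (zpow_ne_zero _ (hr j i))
  have hb0 : b ≠ 0 := Finset.prod_ne_zero_iff.mpr fun j _ =>
    zpow_ne_zero _ (zpow_ne_zero _ (hs j i))
  have hσX : (sigmaZ K n σ g).symm X = a • X := by
    rw [AlgEquiv.symm_apply_eq, map_smul, hX',
      sigmaZ_mon_zsmul σ (fun j => hr j i) (fun j => hσu j i), smul_inv_smul₀ ha0]
  have hσY : (sigmaZ K n σ g).symm Y = b • Y := by
    rw [AlgEquiv.symm_apply_eq, map_smul, hY',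
      sigmaZ_mon_zsmul σ (fun j => hs j i) (fun j => hσv j i), smul_inv_smul₀ hb0]
  have hab : a = b ↔ g i = 0 := by
    have hrest : ∏ j ∈ Finset.univ.erase i, (r j i ^ k) ^ g j =
        ∏ j ∈ Finset.univ.erase i, (s j i ^ k) ^ g j :=
      Finset.prod_congr rfl fun j hj => by rw [hrs j i (Finset.ne_of_mem_erase hj)]
    have hrest0 : ∏ j ∈ Finset.univ.erase i, (s j i ^ k) ^ g j ≠ 0 :=
      Finset.prod_ne_zero_iff.mpr fun j _ => zpow_ne_zero _ (zpow_ne_zero _ (hs j i))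
    rw [ha, hb, ← Finset.mul_prod_erase _ _ (Finset.mem_univ i),
      ← Finset.mul_prod_erase _ _ (Finset.mem_univ i), hrest, mul_left_inj' hrest0,
      ← div_eq_one_iff_eq (zpow_ne_zero _ (zpow_ne_zero _ (hs i i))), ← div_zpow, ← div_zpow,
      ← zpow_mul, zpow_eq_one_iff_of_forall_pow_ne_one (hroot i), mul_eq_zero, or_iff_right hk]
  have hti' : r i i ^ k • X - s i i ^ k • Y ∈ 𝔪 := (hmem _ _).mp hti
  have hmap : ∀ x, x ∈ Ideal.map (sigmaZ K n σ g) 𝔪 ↔ (sigmaZ K n σ g).symm x ∈ 𝔪 := fun x =>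
    Ideal.mem_map_of_equiv (sigmaZ K n σ g) x |>.trans
      ⟨fun ⟨y, hy, hyx⟩ => by rwa [← hyx, AlgEquiv.symm_apply_apply],
        fun h => ⟨_, h, AlgEquiv.apply_symm_apply _ _⟩⟩
  rw [tElt, hmem, hmap, map_sub, map_smul, map_smul, hσX, hσY,
    smul_sub_smul_mem_iff h𝔪.ne_top (zpow_ne_zero _ (hs i i)) (isUnit_mon K n _) hti', hab]

end MTW
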